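/- arXiv:1710.00086 — 3 statements merged into one kernel-verified Lean document; each statement's English description precedes it below -/
import Mathlib

section
/- With the fixed-pair setup in a diregular (2,k,+3)-digraph with k ≥ 3: v ∈ N^{k-1}(u₁) ∪ O(u) and u ∈ N^{k-1}(v₁) ∪ O(v). -/
/-- `p` is a directed walk from `u` to `v` in the digraph with arc relation `A`,
recorded as the list of its vertices; a walk of length `l` (i.e. with `l` arcs)
is a list of `l + 1` vertices. -/
def IsWalkFrom {V : Type*} (A : V → V → Prop) (u v : V) (p : List V) : Prop :=
  p.Chain' A ∧ p.head? = some u ∧ p.getLast? = some v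

/-- A digraph is `k`-geodetic if for every ordered pair of vertices `(u, v)`
there is at most one directed path of length at most `k` from `u` to `v`. -/
def IsKGeodetic {V : Type*} (A : V → V → Prop) (k : ℕ) : Prop :=
  ∀ (u v : V) (p q : List V), IsWalkFrom A u v p → IsWalkFrom A u v q →
    p.length ≤ k + 1 → q.length ≤ k + 1 → p = q

/-- `Nout A u = N⁺(u)`, the set of out-neighbours of `u`. -/
def Nout {V : Type*} (A : V → V → Prop) (u : V) : Set V := {v | A u v}

/-- `Nin A u = N⁻(u)`, the set of in-neighbours of `u`. -/
def Nin {V : Type*} (A : V → V → Prop) (u : V) : Set V := {v | A v u}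

/-- `NIter A l u = N^l(u)`, the set of vertices reachable from `u` by a
directed path of length exactly `l`. -/
def NIter {V : Type*} (A : V → V → Prop) (l : ℕ) (u : V) : Set V :=
  {v | ∃ p : List V, IsWalkFrom A u v p ∧ p.length = l + 1}

/-- `Ball A l u = T_l(u) = N^0(u) ∪ N^1(u) ∪ ⋯ ∪ N^l(u)`, the set of vertices
at distance at most `l` from `u`. -/
def Ball {V : Type*} (A : V → V → Prop) (l : ℕ) (u : V) : Set V :=
  {v | ∃ m ≤ l, v ∈ NIter A m u}

/-- `Outliers A k u = O(u) = {v | d(u,v) ≥ k + 1}`, the outlier set of `u`. -/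
def Outliers {V : Type*} (A : V → V → Prop) (k : ℕ) (u : V) : Set V :=
  {v | v ∉ Ball A k u}

/-- A digraph is diregular with degree `d` if every vertex has out-degree `d`
and in-degree `d`. -/
def IsDiregular {V : Type*} (A : V → V → Prop) (d : ℕ) : Prop :=
  ∀ u : V, (Nout A u).ncard = d ∧ (Nin A u).ncard = d

/-- The Moore bound `M(d,k) = 1 + d + d² + ⋯ + d^k`. -/
def moore (d k : ℕ) : ℕ := ∑ i ∈ Finset.range (k + 1), d ^ i

/-- Appending an arc to a walk gives a walk. -/
theorem IsWalkFrom.concat {V : Type*} {A : V → V → Prop} {x y z : V} {p : List V}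
    (hp : IsWalkFrom A x y p) (hyz : A y z) : IsWalkFrom A x z (p ++ [z]) := by
  obtain ⟨hc, hh, hl⟩ := hp
  refine ⟨List.isChain_append.2 ⟨hc, List.isChain_singleton z, ?_⟩, ?_, ?_⟩
  · intro a ha b hb
    simp_all
  · simp [List.head?_append, hh]
  · simp

/-- In a `k`-geodetic digraph, if `a` and `v` share the out-neighbour `c` and `a ≠ v`, then `v` is
either an outlier of `a` or at distance exactly `k - 1` from the other out-neighbour `b` of `a`. -/
theorem mem_nIter_or_outliers {V : Type*} {A : V → V → Prop} {k : ℕ} {a v b c : V}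
    (hgeo : IsKGeodetic A k) (ha : Nout A a = {b, c}) (hvc : A v c) (hav : a ≠ v) (hk : 1 ≤ k) :
    v ∈ NIter A (k - 1) b ∪ Outliers A k a := by
  by_cases hv : v ∈ Ball A k a
  swap
  · exact Or.inr hv
  left
  obtain ⟨m, hm, p, hp, hlen⟩ := hv
  have hac : A a c := by
    have : c ∈ Nout A a := by simp [ha]
    exact this
  match p, hp, hlen with
  | [], hp, _ => simp [IsWalkFrom] at hp
  | [x], ⟨_, hh, hl⟩, _ =>
    simp only [List.head?_cons, Option.some.injEq, List.getLast?_singleton] at hh hl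
    exact absurd (hh.symm.trans hl) hav
  | x :: w :: t, hp, hlen =>
    obtain ⟨hc, hh, hl⟩ := id hp
    obtain rfl : x = a := by simpa using hh
    obtain ⟨hxw, ht⟩ := List.isChain_cons_cons.1 hc
    have hw : IsWalkFrom A w v (w :: t) := ⟨ht, rfl, by simpa using hl⟩
    simp only [List.length_cons] at hlen
    have hmem : w ∈ Nout A x := hxw
    rw [ha] at hmem
    rcases hmem with rfl | rfl
    · refine ⟨w :: t, hw, ?_⟩
      by_contra hne
      simp only [List.length_cons] at hne
      have heq := hgeo x c _ [x, c] (hp.concat hvc)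
        ⟨List.isChain_pair.2 hac, rfl, rfl⟩ (by simp; omega) (by simp; omega)
      simpa using congrArg List.length heq
    · have heq := hgeo w w _ [w] (hw.concat hvc)
        ⟨List.isChain_singleton w, rfl, rfl⟩ (by simp; omega) (by simp)
      simpa using congrArg List.length heq

/-- Fixed-pair setup, `k ≥ 3`: `v ∈ N^{k-1}(u₁) ∪ O(u)` and
`u ∈ N^{k-1}(v₁) ∪ O(v)`. -/
theorem position_of_v {V : Type*} [Fintype V] (A : V → V → Prop) (k : ℕ)
    (u v u₁ u₂ v₁ : V)
    (hirr : Irreflexive A) (hreg : IsDiregular A 2) (hgeo : IsKGeodetic A k)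
    (hcard : Fintype.card V = moore 2 k + 3)
    (hu : Nout A u = {u₁, u₂}) (hv : Nout A v = {v₁, u₂}) (huv : u₁ ≠ v₁)
    (hk : 3 ≤ k) :
    v ∈ NIter A (k - 1) u₁ ∪ Outliers A k u ∧
      u ∈ NIter A (k - 1) v₁ ∪ Outliers A k v := by
  have hne : u ≠ v := by
    rintro rfl
    have hmem : u₁ ∈ Nout A u := by simp [hu]
    rw [hv] at hmem
    rcases hmem with h | rfl
    · exact huv h
    · have h2 := (hreg u).1
      rw [hu] at h2
      simp at h2
  have huc : A u u₂ := by
    have : u₂ ∈ Nout A u := by simp [hu]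
    exact this
  have hvc : A v u₂ := by
    have : u₂ ∈ Nout A v := by simp [hv]
    exact this
  exact ⟨mem_nIter_or_outliers hgeo hu hvc hne (by omega),
    mem_nIter_or_outliers hgeo hv huc hne.symm (by omega)⟩
end

section
/- With the fixed-pair setup in a diregular (2,k,+3)-digraph with k ≥ 3: if v ∈ O(u) then u₂ ∈ O(u₁), and if u ∈ O(v) then u₂ ∈ O(v₁). -/
/-- A walk between distinct vertices passes through an in-neighbour of its end just before the end. -/
theorem IsWalkFrom.exists_dropLast {V : Type*} {A : V → V → Prop} {x y : V} {p : List V}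
    (h : IsWalkFrom A x y p) (hxy : x ≠ y) :
    ∃ w q, A w y ∧ IsWalkFrom A x w q ∧ p.length = q.length + 1 := by
  obtain ⟨hc, hh, hl⟩ := h
  change List.IsChain A p at hc
  rcases List.eq_nil_or_concat p with rfl | ⟨q, z, rfl⟩
  · simp at hh
  obtain rfl : z = y := by simpa using hl
  rcases List.eq_nil_or_concat q with rfl | ⟨r, w, rfl⟩
  · exact absurd (by simpa using hh.symm) hxy
  have hc' : List.IsChain A ((r ++ [w]) ++ [z]) := by
    simpa only [List.concat_eq_append] using hc
  refine ⟨w, r ++ [w], ?_, ⟨?_, ?_, by simp⟩, by simp⟩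
  · exact (List.isChain_append.1 hc').2.2 w (by simp) z (by simp)
  · exact (List.isChain_append.1 hc').1
  · cases r <;> simpa using hh

theorem IsWalkFrom.cons {V : Type*} {A : V → V → Prop} {x y z : V} {p : List V}
    (h : IsWalkFrom A x y p) (hz : A z x) : IsWalkFrom A z y (z :: p) := by
  obtain ⟨hc, hh, hl⟩ := h
  cases p with
  | nil => simp at hh
  | cons a p =>
    obtain rfl : a = x := by simpa using hh
    exact ⟨List.isChain_cons_cons.2 ⟨hz, hc⟩, rfl, by simpa using hl⟩

/-- A `k`-geodetic digraph has no closed walk of positive length at most `k`. -/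
theorem IsKGeodetic.length_eq_one {V : Type*} {A : V → V → Prop} {k : ℕ}
    (hgeo : IsKGeodetic A k) {x : V} {p : List V} (h : IsWalkFrom A x x p)
    (hp : p.length ≤ k + 1) : p.length = 1 := by
  rw [hgeo x x p [x] h ⟨List.isChain_singleton x, rfl, rfl⟩ hp (by simp)]
  rfl

/-- If `a` and `y` are distinct out-neighbours of `x`, the only in-neighbours of `y` are `x` and
`x'`, and `x'` is an outlier of `x`, then `y` is an outlier of `a`. -/
theorem IsKGeodetic.mem_outliers {V : Type*} {A : V → V → Prop} {k : ℕ}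
    (hgeo : IsKGeodetic A k) {x x' a y : V} (hxa : A x a) (hay : a ≠ y)
    (hin : ∀ w, A w y → w = x ∨ w = x') (hx' : x' ∈ Outliers A k x) :
    y ∈ Outliers A k a := by
  rintro ⟨m, hm, p, hp, hlen⟩
  obtain ⟨w, q, hwy, hq, hpq⟩ := hp.exists_dropLast hay
  have hq' := hq.cons hxa
  rcases hin w hwy with rfl | rfl
  · have h1 := hgeo.length_eq_one hq' (by simp; omega)
    obtain rfl : q = [] := by simpa using h1
    simpa using hq.2.1
  · exact hx' ⟨m, hm, _, hq', by simp; omega⟩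

/-- Fixed-pair setup, `k ≥ 3`: if `v ∈ O(u)` then `u₂ ∈ O(u₁)`, and if
`u ∈ O(v)` then `u₂ ∈ O(v₁)`. -/
theorem outlier_of_neighbour {V : Type*} [Fintype V] (A : V → V → Prop) (k : ℕ)
    (u v u₁ u₂ v₁ : V)
    (hirr : Irreflexive A) (hreg : IsDiregular A 2) (hgeo : IsKGeodetic A k)
    (hcard : Fintype.card V = moore 2 k + 3)
    (hu : Nout A u = {u₁, u₂}) (hv : Nout A v = {v₁, u₂}) (huv : u₁ ≠ v₁)
    (hk : 3 ≤ k) :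
    (v ∈ Outliers A k u → u₂ ∈ Outliers A k u₁) ∧
      (u ∈ Outliers A k v → u₂ ∈ Outliers A k v₁) := by
  have hne : ∀ {x a b : V}, Nout A x = {a, b} → a ≠ b := by
    rintro x a b h rfl
    have := (hreg x).1
    simp [h] at this
  have hu₁ : A u u₁ := by change u₁ ∈ Nout A u; simp [hu]
  have hu₂ : A u u₂ := by change u₂ ∈ Nout A u; simp [hu]
  have hv₁ : A v v₁ := by change v₁ ∈ Nout A v; simp [hv]
  have hv₂ : A v u₂ := by change u₂ ∈ Nout A v; simp [hv]
  have huv' : u ≠ v := by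
    rintro rfl
    have h : u₁ ∈ Nout A u := hu₁
    rw [hv] at h
    exact h.elim huv (hne hu)
  have hin : Nin A u₂ = {u, v} := by
    have hsub : ({u, v} : Set V) ⊆ Nin A u₂ := by
      rintro w (rfl | rfl)
      exacts [hu₂, hv₂]
    refine (Set.eq_of_subset_of_ncard_le hsub ?_).symm
    rw [(hreg u₂).2, Set.ncard_pair huv']
  have hin' : ∀ w, A w u₂ → w = u ∨ w = v := fun w hw => by
    have h : w ∈ Nin A u₂ := hw
    rwa [hin] at h
  exact ⟨hgeo.mem_outliers hu₁ (hne hu) hin',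
    hgeo.mem_outliers hv₁ (hne hv) fun w hw => (hin' w hw).symm⟩
end

section
/- With the fixed-pair setup in a diregular (2,k,+3)-digraph with k ≥ 4: N^+(u₁) ≠ N^+(v₁), i.e. u₁ and v₁ do not have identical out-neighbourhoods. -/
/-- `WalkOfLength A l a b`: there is a directed walk of length `l` from `a` to `b`. -/
def WalkOfLength {V : Type*} (A : V → V → Prop) : ℕ → V → V → Prop
  | 0, a, b => a = b
  | l + 1, a, b => ∃ c, WalkOfLength A l a c ∧ A c b

namespace WalkOfLength

variable {V : Type*} {A : V → V → Prop}

theorem trans {i : ℕ} {a b : V} (h : WalkOfLength A i a b) :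
    ∀ {j : ℕ} {c : V}, WalkOfLength A j b c → WalkOfLength A (i + j) a c
  | 0, _, rfl => h
  | _ + 1, _, ⟨d, hd, hdc⟩ => ⟨d, h.trans hd, hdc⟩

theorem of_adj {a b : V} (h : A a b) : WalkOfLength A 1 a b := ⟨a, rfl, h⟩

theorem snoc {i : ℕ} {a b c : V} (h : WalkOfLength A i a b) (hb : A b c) :
    WalkOfLength A (i + 1) a c := ⟨b, h, hb⟩

theorem cons {i : ℕ} {a b c : V} (hb : A a b) (h : WalkOfLength A i b c) :
    WalkOfLength A (i + 1) a c := by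
  rw [Nat.add_comm]
  exact (of_adj hb).trans h

theorem exists_adj_left {i : ℕ} {a c : V} (h : WalkOfLength A (i + 1) a c) :
    ∃ b, A a b ∧ WalkOfLength A i b c := by
  induction i generalizing c with
  | zero =>
    obtain ⟨_, rfl, h⟩ := h
    exact ⟨c, h, rfl⟩
  | succ i ih =>
    obtain ⟨d, hd, hdc⟩ := h
    obtain ⟨b, hab, hbd⟩ := ih hd
    exact ⟨b, hab, d, hbd, hdc⟩

theorem _root_.IsWalkFrom.concat_s17 {a b c : V} {p : List V} (hp : IsWalkFrom A a b p)
    (hbc : A b c) : IsWalkFrom A a c (p ++ [c]) := by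
  obtain ⟨h1, h2, h3⟩ := hp
  refine ⟨?_, ?_, by simp⟩
  · refine List.isChain_append.2 ⟨h1, by simp, ?_⟩
    intro x hx y hy
    simp_all
  · simp [h2]

theorem exists_list {l : ℕ} {a b : V} (h : WalkOfLength A l a b) :
    ∃ p, IsWalkFrom A a b p ∧ p.length = l + 1 := by
  induction l generalizing b with
  | zero =>
    obtain rfl := h
    exact ⟨[a], ⟨List.isChain_singleton a, rfl, rfl⟩, rfl⟩
  | succ l ih =>
    obtain ⟨c, hc, hcb⟩ := h
    obtain ⟨p, hp, hl⟩ := ih hc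
    exact ⟨p ++ [b], hp.concat_s17 hcb, by simp [hl]⟩

theorem length_unique {k i j : ℕ} {a b : V} (hgeo : IsKGeodetic A k)
    (hi : WalkOfLength A i a b) (hj : WalkOfLength A j a b) (hik : i ≤ k) (hjk : j ≤ k) :
    i = j := by
  obtain ⟨p, hp, hpl⟩ := hi.exists_list
  obtain ⟨q, hq, hql⟩ := hj.exists_list
  have := hgeo a b p q hp hq (by omega) (by omega)
  subst this
  omega

theorem penultimate_unique {k i j : ℕ} {a b c d : V} (hgeo : IsKGeodetic A k)
    (hi : WalkOfLength A i a c) (hj : WalkOfLength A j a d) (hc : A c b) (hd : A d b)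
    (hik : i + 1 ≤ k) (hjk : j + 1 ≤ k) : c = d := by
  obtain ⟨p, hp, hpl⟩ := hi.exists_list
  obtain ⟨q, hq, hql⟩ := hj.exists_list
  have h := hgeo a b _ _ (hp.concat_s17 hc) (hq.concat_s17 hd) (by simp; omega) (by simp; omega)
  have h' : p = q := by simpa using h
  subst h'
  simpa [hp.2.2] using hq.2.2

end WalkOfLength

/-- The vertices from which `b` can be reached by a directed walk of length at most `l`. -/
def InBall {V : Type*} (A : V → V → Prop) (l : ℕ) (b : V) : Set V :=
  {a | ∃ i ≤ l, WalkOfLength A i a b}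

theorem InBall.two_pow_le_ncard {V : Type*} [Finite V] {A : V → V → Prop} {k : ℕ}
    (hin : ∀ b, (Nin A b).ncard = 2) (hgeo : IsKGeodetic A k) (l : ℕ) (hl : l ≤ k) (b : V) :
    2 ^ (l + 1) ≤ (InBall A l b).ncard + 1 := by
  induction l generalizing b with
  | zero =>
    have : (InBall A 0 b).Nonempty := ⟨b, 0, le_rfl, rfl⟩
    have := this.ncard_pos
    omega
  | succ l ih =>
    obtain ⟨c, d, hcd, hN⟩ := Set.ncard_eq_two.1 (hin b)
    have hc : A c b := by
      have : c ∈ Nin A b := by simp [hN]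
      exact this
    have hd : A d b := by
      have : d ∈ Nin A b := by simp [hN]
      exact this
    have hdisj : Disjoint (InBall A l c) (InBall A l d) := by
      rw [Set.disjoint_left]
      rintro a ⟨i, hi, hai⟩ ⟨j, hj, haj⟩
      exact hcd (hai.penultimate_unique hgeo haj hc hd (by omega) (by omega))
    have hb : b ∉ InBall A l c ∪ InBall A l d := by
      have hclosed : ∀ e, A e b → b ∉ InBall A l e := by
        rintro e he ⟨i, hi, hw⟩
        have := (hw.snoc he).length_unique hgeo (j := 0) rfl (by omega) (by omega)
        omega
      rintro (h | h)
      exacts [hclosed c hc h, hclosed d hd h]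
    have hsub : insert b (InBall A l c ∪ InBall A l d) ⊆ InBall A (l + 1) b := by
      rintro a (rfl | ⟨i, hi, hw⟩ | ⟨i, hi, hw⟩)
      · exact ⟨0, by omega, rfl⟩
      · exact ⟨i + 1, by omega, hw.snoc hc⟩
      · exact ⟨i + 1, by omega, hw.snoc hd⟩
    have hle := Set.ncard_le_ncard hsub
    rw [Set.ncard_insert_of_notMem hb, Set.ncard_union_eq hdisj] at hle
    have h1 := ih (by omega) c
    have h2 := ih (by omega) d
    rw [pow_succ]
    omega

theorem moore_two_add_one (k : ℕ) : moore 2 k + 1 = 2 ^ (k + 1) := by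
  induction k with
  | zero => simp [moore]
  | succ k ih =>
    rw [moore, Finset.sum_range_succ, ← moore, pow_succ 2 (k + 1)]
    omega

theorem ncard_compl_inBall_le {V : Type*} [Fintype V] {A : V → V → Prop} {k e : ℕ}
    (hin : ∀ b, (Nin A b).ncard = 2) (hgeo : IsKGeodetic A k)
    (hcard : Fintype.card V = moore 2 k + e) (b : V) :
    (InBall A k b)ᶜ.ncard ≤ e := by
  have h1 := Set.ncard_add_ncard_compl (InBall A k b)
  have h2 := InBall.two_pow_le_ncard hin hgeo k le_rfl b
  have h3 := moore_two_add_one k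
  rw [Nat.card_eq_fintype_card] at h1
  omega

/-- If two vertices `u`, `v` share the out-neighbour `u₂`, and their other out-neighbours
have the same out-neighbourhood, then `u₂` is an outlier of `u₁`. -/
theorem notMem_inBall_of_common_out {V : Type*} {A : V → V → Prop} {k : ℕ}
    {u v u₁ u₂ v₁ : V} (hgeo : IsKGeodetic A k) (hk : 4 ≤ k)
    (hin : ∀ x, A x u₂ → x = u ∨ x = v)
    (hout : ∀ x, A u x → x = u₁ ∨ x = u₂) (huu₁ : A u u₁) (huu₂ : A u u₂) (hvv₁ : A v v₁)
    (hvu₂ : A v u₂) (hne : u ≠ v) (h12 : u₁ ≠ u₂)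
    (hN : ∀ x, A u₁ x ↔ A v₁ x) : u₁ ∉ InBall A k u₂ := by
  have hOut : u ∉ InBall A k v := by
    rintro ⟨i, hi, hw⟩
    rcases i with _ | i
    · exact hne hw
    obtain ⟨c, hc, hcw⟩ := hw.exists_adj_left
    rcases hout c hc with rfl | rfl
    · rcases i with _ | i
      · obtain rfl : c = v := hcw
        have := (WalkOfLength.of_adj huu₂).length_unique hgeo
          ((WalkOfLength.of_adj huu₁).snoc hvu₂) (by omega) (by omega)
        omega
      · obtain ⟨d, hd, hdw⟩ := hcw.exists_adj_left
        have := ((hdw.cons ((hN d).1 hd)).cons hvv₁).length_unique hgeo (j := 0) rfl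
          (by omega) (by omega)
        omega
    · have := (hcw.cons hvu₂).length_unique hgeo (j := 0) rfl (by omega) (by omega)
      omega
  rintro ⟨i, hi, hw⟩
  rcases i with _ | i
  · exact h12 hw
  obtain ⟨c, hc, hcu₂⟩ := hw
  rcases hin c hcu₂ with rfl | rfl
  · have := (hc.cons huu₁).length_unique hgeo (j := 0) rfl (by omega) (by omega)
    omega
  · exact hOut ⟨i + 1, by omega, hc.cons huu₁⟩

/-- An in-neighbour `u' ≠ u` of `u₁` and an in-neighbour `w` of `u'` cannot both reach `u₂`
within distance `k`. -/
theorem not_both_mem_inBall {V : Type*} {A : V → V → Prop} {k : ℕ}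
    {u v u₁ u₂ v₁ u₃ u' w : V} (hgeo : IsKGeodetic A k) (hk : 4 ≤ k)
    (hin : ∀ x, A x u₂ → x = u ∨ x = v)
    (huu₁ : A u u₁) (huu₂ : A u u₂) (hvv₁ : A v v₁) (h12 : u₁ ≠ u₂) (huv : u₁ ≠ v₁)
    (h3 : A u₁ u₃) (h3' : A v₁ u₃) (hu' : A u' u₁) (hne : u' ≠ u) (hw : A w u')
    (hu'₂ : u' ∈ InBall A k u₂) (hw₂ : w ∈ InBall A k u₂) : False := by
  have key : ∀ p i, i ≤ k - 2 → WalkOfLength A i p u' → p ∈ InBall A k u₂ →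
      WalkOfLength A (k - 1) p v := by
    rintro p i hi hp ⟨j, hj, hpj⟩
    rcases j with _ | j
    · obtain rfl : p = u₂ := hpj
      have := ((hp.snoc hu').cons huu₂).length_unique hgeo (WalkOfLength.of_adj huu₁)
        (by omega) (by omega)
      omega
    obtain ⟨c, hc, hcu₂⟩ := hpj
    rcases hin c hcu₂ with rfl | rfl
    · exact absurd (hp.penultimate_unique hgeo hc hu' huu₁ (by omega) (by omega)) hne
    · by_cases hjk : j = k - 1
      · exact hjk ▸ hc
      · exact absurd ((hp.snoc hu').penultimate_unique hgeo (hc.snoc hvv₁) h3 h3'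
          (by omega) (by omega)) huv
  have h1 := key u' 0 (by omega) rfl hu'₂
  have h2 := key w 1 (by omega) (.of_adj hw) hw₂
  have := (h1.cons hw).length_unique hgeo h2 (by omega) (by omega)
  omega

/-- A vertex with a nonempty walk of length less than `k` to `u₁` differs from `u₁` and from any
vertex `v₁` that has a common out-neighbour with `u₁`. -/
theorem ne_of_walk_to {V : Type*} {A : V → V → Prop} {k i : ℕ} {u₁ v₁ u₃ p : V}
    (hgeo : IsKGeodetic A k) (h3 : A u₁ u₃) (h3' : A v₁ u₃)
    (hi : 0 < i) (hik : i + 1 ≤ k) (hp : WalkOfLength A i p u₁) : p ≠ u₁ ∧ p ≠ v₁ := by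
  constructor
  · rintro rfl
    have := hp.length_unique hgeo (j := 0) rfl (by omega) (by omega)
    omega
  · rintro rfl
    have := (hp.snoc h3).length_unique hgeo (.of_adj h3') (by omega) (by omega)
    omega

/-- Fixed-pair setup, `k ≥ 4`: `u₁` and `v₁` do not have identical
out-neighbourhoods. -/
theorem neighbourhoods_not_equal {V : Type*} [Fintype V] (A : V → V → Prop) (k : ℕ)
    (u v u₁ u₂ v₁ : V)
    (hirr : Irreflexive A) (hreg : IsDiregular A 2) (hgeo : IsKGeodetic A k)
    (hcard : Fintype.card V = moore 2 k + 3)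
    (hu : Nout A u = {u₁, u₂}) (hv : Nout A v = {v₁, u₂}) (huv : u₁ ≠ v₁)
    (hk : 4 ≤ k) :
    Nout A u₁ ≠ Nout A v₁ := by
  intro hN
  have hout : ∀ b, (Nout A b).ncard = 2 := fun b => (hreg b).1
  have hin : ∀ b, (Nin A b).ncard = 2 := fun b => (hreg b).2
  have hu_iff : ∀ x, A u x ↔ x = u₁ ∨ x = u₂ := fun x => Set.ext_iff.1 hu x
  have hv_iff : ∀ x, A v x ↔ x = v₁ ∨ x = u₂ := fun x => Set.ext_iff.1 hv x
  have hN_iff : ∀ x, A u₁ x ↔ A v₁ x := fun x => Set.ext_iff.1 hN x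
  have huu₁ : A u u₁ := (hu_iff _).2 (.inl rfl)
  have huu₂ : A u u₂ := (hu_iff _).2 (.inr rfl)
  have hvv₁ : A v v₁ := (hv_iff _).2 (.inl rfl)
  have hvu₂ : A v u₂ := (hv_iff _).2 (.inr rfl)
  have h12 : u₁ ≠ u₂ := by
    rintro rfl
    have := hout u
    simp [hu] at this
  have h12' : v₁ ≠ u₂ := by
    rintro rfl
    have := hout v
    simp [hv] at this
  have hne : u ≠ v := by
    rintro rfl
    rcases (hv_iff u₁).1 huu₁ with h | h
    exacts [huv h, h12 h]
  have hin₂ : ∀ x, A x u₂ → x = u ∨ x = v := by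
    have hsub : ({u, v} : Set V) ⊆ Nin A u₂ := by
      rintro x (rfl | rfl)
      exacts [huu₂, hvu₂]
    have heq := Set.eq_of_subset_of_ncard_le hsub (by rw [hin, Set.ncard_pair hne])
    intro x hx
    have : x ∈ Nin A u₂ := hx
    rwa [← heq] at this
  obtain ⟨u₃, h3⟩ : ∃ x, A u₁ x := (Set.ncard_pos (s := Nout A u₁)).1 (by rw [hout]; omega)
  have h3' := (hN_iff _).1 h3
  have other : ∀ b c, ∃ d, A d b ∧ d ≠ c := fun b c =>
    Set.exists_ne_of_one_lt_ncard (s := Nin A b) (by rw [hin]; omega) c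
  obtain ⟨u', hu', hu'ne⟩ := other u₁ u
  obtain ⟨w, hw, -⟩ := other u' u
  obtain ⟨v', hv', hv'ne⟩ := other v₁ v
  obtain ⟨x, hx, -⟩ := other v' v
  have o₁ := notMem_inBall_of_common_out hgeo hk hin₂ (fun x => (hu_iff x).1) huu₁ huu₂ hvv₁
    hvu₂ hne h12 hN_iff
  have o₂ := notMem_inBall_of_common_out hgeo hk (fun x h => (hin₂ x h).symm)
    (fun x => (hv_iff x).1) hvv₁ hvu₂ huu₁ huu₂ hne.symm h12' (fun x => (hN_iff x).symm)
  have outlier_unique : ∀ p q, p ∉ InBall A k u₂ → q ∉ InBall A k u₂ →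
      p ≠ u₁ ∧ p ≠ v₁ → q ≠ u₁ ∧ q ≠ v₁ → p = q := by
    intro p q hp hq ⟨hp₁, hp₂⟩ ⟨hq₁, hq₂⟩
    by_contra hpq
    have hsub : ({p, q, u₁, v₁} : Set V) ⊆ (InBall A k u₂)ᶜ := by
      rintro y (rfl | rfl | rfl | rfl)
      exacts [hp, hq, o₁, o₂]
    have h1 := Set.ncard_le_ncard hsub
    have h2 := ncard_compl_inBall_le hin hgeo hcard u₂
    rw [Set.ncard_insert_of_notMem (by simp [*]), Set.ncard_insert_of_notMem (by simp [*]),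
      Set.ncard_pair huv] at h1
    omega
  have disjoint_reach : ∀ p i j, i ≤ 2 → j ≤ 2 → WalkOfLength A i p u₁ →
      WalkOfLength A j p v₁ → False := fun p i j hi hj h1 h2 =>
    huv (h1.penultimate_unique hgeo h2 h3 h3' (by omega) (by omega))
  have wu : ∃ p i, 0 < i ∧ i ≤ 2 ∧ WalkOfLength A i p u₁ ∧ p ∉ InBall A k u₂ := by
    by_contra! hcon
    exact not_both_mem_inBall hgeo hk hin₂ huu₁ huu₂ hvv₁ h12 huv h3 h3' hu' hu'ne hw
      (hcon u' 1 (by omega) (by omega) (.of_adj hu'))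
      (hcon w 2 (by omega) (by omega) ((WalkOfLength.of_adj hw).snoc hu'))
  have wv : ∃ p i, 0 < i ∧ i ≤ 2 ∧ WalkOfLength A i p v₁ ∧ p ∉ InBall A k u₂ := by
    by_contra! hcon
    exact not_both_mem_inBall hgeo hk (fun x h => (hin₂ x h).symm) hvv₁ hvu₂ huu₁ h12'
      huv.symm h3' h3 hv' hv'ne hx
      (hcon v' 1 (by omega) (by omega) (.of_adj hv'))
      (hcon x 2 (by omega) (by omega) ((WalkOfLength.of_adj hx).snoc hv'))
  obtain ⟨p, i, hi, hi2, hpw, hp⟩ := wu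
  obtain ⟨q, j, hj, hj2, hqw, hq⟩ := wv
  obtain rfl := outlier_unique p q hp hq (ne_of_walk_to hgeo h3 h3' hi (by omega) hpw)
    (ne_of_walk_to hgeo h3' h3 hj (by omega) hqw).symm
  exact disjoint_reach p i j hi2 hj2 hpw hqw
end
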